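/- Let μ be a finite Borel measure on ℝ with Borel transform F, and let a < b be real numbers. If there are at most countably many x ∈ (a, b) such that both Im F(x+iy) → +∞ and y·F(x+iy) → 0 as y ↘ 0, then the singular continuous part of μ vanishes on (a, b): μ_sc((a, b)) = 0. -/

import Mathlib

open MeasureTheory Filter Complex Set

/-- The Borel transform of a measure on `ℝ`. -/
noncomputable def borelTransform (μ : Measure ℝ) (z : ℂ) : ℂ :=
  ∫ t : ℝ, (1 : ℂ) / ((t : ℂ) - z) ∂μ

/-- The singular continuous part of a finite Borel measure on `ℝ`: the restriction of the
singular part (w.r.t. Lebesgue measure) to the set of points with no point mass. -/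
noncomputable def scPart (μ : Measure ℝ) : Measure ℝ :=
  (μ.singularPart volume).restrict {x : ℝ | μ {x} = 0}

/-- `y F(x + iy) → 0` as `y ↘ 0` at every point `x` that carries no mass. -/
theorem tendsto_mul_borelTransform_of_measure_singleton_eq_zero (μ : Measure ℝ)
    [IsFiniteMeasure μ] {x : ℝ} (hx : μ {x} = 0) :
    Tendsto (fun y : ℝ => (y : ℂ) * borelTransform μ ((x : ℂ) + y * Complex.I))
      (nhdsWithin 0 (Set.Ioi 0)) (nhds 0) := by
  have key : Tendsto
      (fun y : ℝ => ∫ t : ℝ, (y : ℂ) * ((1 : ℂ) / ((t : ℂ) - ((x : ℂ) + y * Complex.I))) ∂μ)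
      (nhdsWithin 0 (Set.Ioi 0)) (nhds (∫ _ : ℝ, (0 : ℂ) ∂μ)) := by
    refine tendsto_integral_filter_of_dominated_convergence (fun _ => 1) ?_ ?_
      (integrable_const _) ?_
    · exact Eventually.of_forall fun y => (by fun_prop : Measurable _).aestronglyMeasurable
    · filter_upwards [self_mem_nhdsWithin] with y hy
      refine Eventually.of_forall fun t => ?_
      have hy' : (0 : ℝ) < y := hy
      have h1 : y ≤ ‖(t : ℂ) - ((x : ℂ) + y * Complex.I)‖ := by
        have := Complex.abs_im_le_norm ((t : ℂ) - ((x : ℂ) + y * Complex.I))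
        simpa [abs_of_pos hy'] using this
      rw [norm_mul, norm_div, norm_one, Complex.norm_real, Real.norm_of_nonneg hy'.le,
        mul_one_div]
      exact div_le_one_of_le₀ h1 (norm_nonneg _)
    · have hne : ∀ᵐ t ∂μ, t ≠ x := by
        rw [ae_iff]
        simpa using hx
      filter_upwards [hne] with t ht
      have htx : (t : ℂ) - x ≠ 0 := sub_ne_zero.mpr (by exact_mod_cast ht)
      have hc : ContinuousAt
          (fun y : ℝ => (y : ℂ) * ((1 : ℂ) / ((t : ℂ) - ((x : ℂ) + y * Complex.I)))) 0 := by
        refine ContinuousAt.mul (by fun_prop) (ContinuousAt.div (by fun_prop) (by fun_prop) ?_)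
        simpa using htx
      simpa using hc.tendsto.mono_left nhdsWithin_le_nhds
  simpa [borelTransform, integral_const_mul] using key

/-- The Poisson kernel dominates half the normalized indicator of the ball of radius `y`. -/
theorem measureReal_closedBall_div_le_im_borelTransform (μ : Measure ℝ) [IsFiniteMeasure μ]
    (x : ℝ) {y : ℝ} (hy : 0 < y) :
    μ.real (Metric.closedBall x y) / (2 * y) ≤
      (borelTransform μ ((x : ℂ) + y * Complex.I)).im := by
  have hint : Integrable (fun t : ℝ => (1 : ℂ) / ((t : ℂ) - ((x : ℂ) + y * Complex.I))) μ := by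
    refine Integrable.of_bound (by fun_prop : Measurable _).aestronglyMeasurable (1 / y)
      (Eventually.of_forall fun t => ?_)
    have h1 : y ≤ ‖(t : ℂ) - ((x : ℂ) + y * Complex.I)‖ := by
      have := Complex.abs_im_le_norm ((t : ℂ) - ((x : ℂ) + y * Complex.I))
      simpa [abs_of_pos hy] using this
    rw [norm_div, norm_one]
    exact one_div_le_one_div_of_le hy h1
  have him : ∀ t : ℝ, ((1 : ℂ) / ((t : ℂ) - ((x : ℂ) + y * Complex.I))).im =
      y / ((t - x) ^ 2 + y ^ 2) := by
    intro t
    simp [Complex.inv_im, Complex.normSq_apply, pow_two]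
  have hF : (borelTransform μ ((x : ℂ) + y * Complex.I)).im =
      ∫ t : ℝ, y / ((t - x) ^ 2 + y ^ 2) ∂μ := by
    simp_rw [← him]
    exact (integral_im hint).symm
  have hint' : Integrable (fun t : ℝ => y / ((t - x) ^ 2 + y ^ 2)) μ := by
    simp_rw [← him]
    exact hint.im
  have hI : ∫ t : ℝ, (Metric.closedBall x y).indicator (fun _ => 1 / (2 * y)) t ∂μ =
      μ.real (Metric.closedBall x y) / (2 * y) := by
    rw [integral_indicator_const _ Metric.isClosed_closedBall.measurableSet, smul_eq_mul,
      mul_one_div]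
  rw [hF, ← hI]
  refine integral_mono
    ((integrable_const _).indicator Metric.isClosed_closedBall.measurableSet) hint' fun t => ?_
  by_cases ht : t ∈ Metric.closedBall x y
  · rw [Set.indicator_of_mem ht]
    rw [Metric.mem_closedBall, Real.dist_eq] at ht
    have hsq : (t - x) ^ 2 ≤ y ^ 2 := sq_le_sq.mpr (by rwa [abs_of_pos hy])
    rw [div_le_div_iff₀ (by positivity) (by positivity)]
    nlinarith
  · rw [Set.indicator_of_notMem ht]
    positivity

/-- The symmetric derivative of a measure singular with respect to Lebesgue measure is infinite
almost everywhere. -/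
theorem ae_tendsto_measureReal_closedBall_div_atTop {ν : Measure ℝ} [IsFiniteMeasure ν]
    (hν : ν ⟂ₘ volume) :
    ∀ᵐ x ∂ν, Tendsto (fun y : ℝ => ν.real (Metric.closedBall x y) / (2 * y))
      (nhdsWithin 0 (Set.Ioi 0)) atTop := by
  filter_upwards [Besicovitch.ae_tendsto_rnDeriv (volume : Measure ℝ) ν,
    (Measure.rnDeriv_eq_zero _ _).mpr hν.symm] with x hx h0
  rw [h0, Pi.zero_apply] at hx
  have h2 := (ENNReal.tendsto_toReal ENNReal.zero_ne_top).comp hx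
  have h3 : Tendsto (fun y : ℝ => 2 * y / ν.real (Metric.closedBall x y))
      (nhdsWithin 0 (Set.Ioi 0)) (nhds 0) := by
    refine h2.congr' ?_
    filter_upwards [self_mem_nhdsWithin] with y hy
    have hy' : (0 : ℝ) < y := hy
    simp [Real.volume_closedBall, ENNReal.toReal_div, measureReal_def, hy'.le]
  have hpos : ∀ᶠ y : ℝ in nhdsWithin 0 (Set.Ioi 0),
      0 < 2 * y / ν.real (Metric.closedBall x y) := by
    filter_upwards [self_mem_nhdsWithin, hx.eventually (gt_mem_nhds ENNReal.zero_lt_top)]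
      with y hy hlt
    have hy' : (0 : ℝ) < y := hy
    have hνy : ν (Metric.closedBall x y) ≠ 0 := by
      intro h
      rw [h, ENNReal.div_zero (by simpa [Real.volume_closedBall] using hy')] at hlt
      exact lt_irrefl _ hlt
    have : 0 < ν.real (Metric.closedBall x y) :=
      ENNReal.toReal_pos hνy (measure_ne_top _ _)
    positivity
  refine (tendsto_nhdsWithin_iff.mpr ⟨h3, hpos⟩).inv_tendsto_nhdsGT_zero.congr fun y => ?_
  simp only [Pi.inv_apply, inv_div]

/-- If there are at most countably many `x ∈ (a, b)` with `Im F(x+iy) → +∞` and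
`y·F(x+iy) → 0` as `y ↘ 0`, then the singular continuous part of `μ` vanishes on `(a, b)`. -/
theorem scPart_eq_zero_of_countable (μ : Measure ℝ) [IsFiniteMeasure μ] (a b : ℝ)
    (hab : a < b)
    (hcount :
      Set.Countable {x : ℝ | x ∈ Set.Ioo a b ∧
        Tendsto (fun y : ℝ => (borelTransform μ ((x : ℂ) + y * Complex.I)).im)
          (nhdsWithin 0 (Set.Ioi 0)) atTop ∧
        Tendsto (fun y : ℝ => (y : ℂ) * borelTransform μ ((x : ℂ) + y * Complex.I))
          (nhdsWithin 0 (Set.Ioi 0)) (nhds 0)}) :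
    scPart μ (Set.Ioo a b) = 0 := by
  have hsing := Measure.mutuallySingular_singularPart μ (volume : Measure ℝ)
  have hle := Measure.singularPart_le μ (volume : Measure ℝ)
  rw [scPart, Measure.restrict_apply measurableSet_Ioo]
  set C := {x : ℝ | x ∈ Set.Ioo a b ∧
        Tendsto (fun y : ℝ => (borelTransform μ ((x : ℂ) + y * Complex.I)).im)
          (nhdsWithin 0 (Set.Ioi 0)) atTop ∧
        Tendsto (fun y : ℝ => (y : ℂ) * borelTransform μ ((x : ℂ) + y * Complex.I))
          (nhdsWithin 0 (Set.Ioi 0)) (nhds 0)}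
  have hnull : μ.singularPart volume (C ∩ {x : ℝ | μ {x} = 0}) = 0 := by
    refine hle.absolutelyContinuous ?_
    rw [← Set.biUnion_of_singleton (C ∩ {x : ℝ | μ {x} = 0}),
      measure_biUnion_null_iff (hcount.mono Set.inter_subset_left)]
    exact fun x hx => hx.2
  refine measure_mono_null_ae ?_ hnull
  filter_upwards [ae_tendsto_measureReal_closedBall_div_atTop hsing] with x hx hmem
  refine ⟨⟨hmem.1, ?_, tendsto_mul_borelTransform_of_measure_singleton_eq_zero μ hmem.2⟩, hmem.2⟩
  refine tendsto_atTop_mono' _ ?_ hx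
  filter_upwards [self_mem_nhdsWithin] with y hy
  have hy' : (0 : ℝ) < y := hy
  refine le_trans ?_ (measureReal_closedBall_div_le_im_borelTransform μ x hy')
  gcongr
  exact ENNReal.toReal_mono (measure_ne_top _ _) (hle _)
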